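/- Let k ≥ 1 and 0 ≤ m ≤ k. Then in ℚ[[q]]: Σ_{λ_1 ≥ … ≥ λ_k ≥ 0} ((−q)_{λ_1} · q^{λ_1(λ_1+1)/2 + Σ_{i=2}^k (λ_i² + λ_i)} / (q)_λ) · (2 Σ_{i=0}^{m−1} q^{Σ_{j=0}^{i−1} (λ_{k−j} + 1)} + q^{Σ_{j=0}^{m−1} (λ_{k−j} + 1)}) = Σ_{λ_1 ≥ … ≥ λ_k ≥ 0} (−q)_{λ_1} · q^{λ_1(λ_1−1)/2 + Σ_{i=2}^{k} λ_i² + Σ_{i=m+1}^k λ_i} / (q)_λ. Here an empty sum Σ_{j=0}^{−1} is 0, so the i = 0 term of the first bracket equals 2, and the empty sum Σ_{j=0}^{m−1} equals 0 when m = 0. -/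

import Mathlib

open PowerSeries

noncomputable section

/-- The product (coefficientwise) topology on `ℚ⟦X⟧`. -/
instance : TopologicalSpace ℚ⟦X⟧ :=
  inferInstanceAs (TopologicalSpace ((Unit →₀ ℕ) → ℚ))

/-- `(q)_n = ∏_{i=1}^n (1 - q^i)` in `ℚ⟦X⟧`. -/
def qp (n : ℕ) : ℚ⟦X⟧ := ∏ i ∈ Finset.range n, (1 - X ^ (i + 1))

/-- `(-q)_n = ∏_{i=1}^n (1 + q^i)` in `ℚ⟦X⟧`. -/
def nqp (n : ℕ) : ℚ⟦X⟧ := ∏ i ∈ Finset.range n, (1 + X ^ (i + 1))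

/-- The Gaussian binomial `[M, N]_q`, zero unless `M ≥ N`. -/
def qbinom (M N : ℕ) : ℚ⟦X⟧ :=
  if N ≤ M then qp M * ((qp N)⁻¹ * (qp (M - N))⁻¹) else 0

/-- Weakly decreasing tuples `f 0 ≥ f 1 ≥ … ≥ f (r-1) ≥ 0`, encoded as
antitone functions `ℕ → ℕ` vanishing from index `r` on. -/
def DecTuple (r : ℕ) : Type :=
  {f : ℕ → ℕ // (∀ ⦃i j : ℕ⦄, i ≤ j → f j ≤ f i) ∧ ∀ i, r ≤ i → f i = 0}

/-- `(q)_λ = (q)_{λ_1-λ_2} ⋯ (q)_{λ_{r-1}-λ_r} (q)_{λ_r}` for a weakly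
decreasing tuple `λ` (0-indexed). -/
def qpT (r : ℕ) (f : ℕ → ℕ) : ℚ⟦X⟧ := ∏ i ∈ Finset.range r, qp (f i - f (i + 1))

instance : IsTopologicalRing ℚ⟦X⟧ :=
  PowerSeries.WithPiTopology.instIsTopologicalRing ℚ

instance : T3Space ℚ⟦X⟧ :=
  inferInstanceAs (T3Space ((Unit →₀ ℕ) → ℚ))

theorem summable_of_finite_coeff {ι : Type*} {f : ι → ℚ⟦X⟧}
    (h : ∀ d, {i | coeff d (f i) ≠ 0}.Finite) : Summable f := by
  exact (PowerSeries.WithPiTopology.summable_iff_summable_coeff (R := ℚ)).2 fun d =>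
    summable_of_hasFiniteSupport (h d)

theorem summable_of_X_pow_dvd {f : ℕ → ℚ⟦X⟧} (h : ∀ n, X ^ (n - 1) ∣ f n) : Summable f := by
  refine summable_of_finite_coeff fun d => (Set.finite_Iic (d + 1)).subset fun n hn => ?_
  by_contra hlt
  simp only [Set.mem_Iic, not_le] at hlt
  exact hn (X_pow_dvd_iff.1 (h n) d (by omega))

/-- The product `(-q^{a+1})_n = ∏_{i=1}^n (1 + q^{a+i})`. -/
def nqps (a n : ℕ) : ℚ⟦X⟧ := ∏ i ∈ Finset.range n, (1 + X ^ (a + i + 1))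

/-- The weighted sum `∑ₙ (-q^{a+1})_n q^{n(n-1)/2} / (q)_n · g n`. -/
def wsum (a : ℕ) (g : ℕ → ℚ⟦X⟧) : ℚ⟦X⟧ :=
  ∑' n, nqps a n * X ^ (n * (n - 1) / 2) * (qp n)⁻¹ * g n

theorem pred_le_choose_two (n : ℕ) : n - 1 ≤ n * (n - 1) / 2 := by
  rcases n with _ | _ | n
  · simp
  · simp
  · rw [Nat.le_div_iff_mul_le two_pos]
    simp only [Nat.add_sub_cancel]
    nlinarith

theorem summable_wsum (a : ℕ) (g : ℕ → ℚ⟦X⟧) :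
    Summable fun n => nqps a n * X ^ (n * (n - 1) / 2) * (qp n)⁻¹ * g n :=
  summable_of_X_pow_dvd fun n =>
    (((pow_dvd_pow X (pred_le_choose_two n)).mul_left _).mul_right _).mul_right _

theorem wsum_add (a : ℕ) (g h : ℕ → ℚ⟦X⟧) :
    wsum a (fun n => g n + h n) = wsum a g + wsum a h := by
  simp only [wsum, mul_add]
  exact (summable_wsum a g).tsum_add (summable_wsum a h)

theorem wsum_sub (a : ℕ) (g h : ℕ → ℚ⟦X⟧) :
    wsum a (fun n => g n - h n) = wsum a g - wsum a h := by
  simp only [wsum, mul_sub]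
  exact (summable_wsum a g).tsum_sub (summable_wsum a h)

theorem wsum_mul_left (a : ℕ) (r : ℚ⟦X⟧) (g : ℕ → ℚ⟦X⟧) :
    wsum a (fun n => r * g n) = r * wsum a g := by
  simp only [wsum, mul_left_comm _ r]
  exact (summable_wsum a g).tsum_mul_left r

theorem constantCoeff_qp (n : ℕ) : constantCoeff (qp n) = 1 := by
  simp [qp, map_prod]

theorem qp_mul_inv (n : ℕ) : qp n * (qp n)⁻¹ = 1 :=
  PowerSeries.mul_inv_cancel _ (by simp [constantCoeff_qp])

theorem one_sub_mul_qp_succ_inv (n : ℕ) : (1 - X ^ (n + 1)) * (qp (n + 1))⁻¹ = (qp n)⁻¹ := by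
  have h : qp (n + 1) = qp n * (1 - X ^ (n + 1)) := Finset.prod_range_succ _ _
  linear_combination (-(1 - X ^ (n + 1)) * (qp (n + 1))⁻¹) * qp_mul_inv n +
    (qp n)⁻¹ * qp_mul_inv (n + 1) - (qp n)⁻¹ * (qp (n + 1))⁻¹ * h

theorem nqps_succ (a n : ℕ) : nqps a (n + 1) = nqps a n * (1 + X ^ (a + n + 1)) :=
  Finset.prod_range_succ _ _

theorem nqps_add (a n l : ℕ) : nqps a (l + n) = nqps a n * nqps (a + n) l := by
  rw [add_comm l n]
  simp only [nqps, Finset.prod_range_add, add_assoc]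

theorem choose_two_add (n l : ℕ) :
    (l + n) * (l + n - 1) / 2 = l * (l - 1) / 2 + n * (n - 1) / 2 + n * l := by
  induction n with
  | zero => simp
  | succ n ih =>
    rw [← Nat.choose_two_right, ← Nat.choose_two_right, ← Nat.choose_two_right] at *
    rw [← add_assoc, Nat.choose_succ_succ', Nat.choose_succ_succ' n, ih]
    simp only [Nat.choose_one_right]
    ring

theorem wsum_one_sub_mul (a : ℕ) (g : ℕ → ℚ⟦X⟧) :
    wsum a (fun n => (1 - X ^ n) * g n) =
      wsum a (fun n => X ^ n * (1 + X ^ (a + n + 1)) * g (n + 1)) := by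
  unfold wsum
  rw [(summable_wsum a fun n => (1 - X ^ n) * g n).tsum_eq_zero_add]
  simp only [pow_zero, sub_self, zero_mul, mul_zero, zero_add]
  refine tsum_congr fun n => ?_
  rw [add_comm n 1, choose_two_add n 1, add_comm 1 n, ← one_sub_mul_qp_succ_inv n, nqps_succ]
  simp only [pow_add]
  norm_num
  ring

theorem one_add_mul_wsum_succ (a : ℕ) (g : ℕ → ℚ⟦X⟧) :
    (1 + X ^ (a + 1)) * wsum (a + 1) g = wsum a (fun n => (1 + X ^ (a + n + 1)) * g n) := by
  unfold wsum
  rw [← (summable_wsum _ _).tsum_mul_left]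
  refine tsum_congr fun n => ?_
  have h : (1 + X ^ (a + 1)) * nqps (a + 1) n = nqps a n * (1 + X ^ (a + n + 1)) := by
    rw [← nqps_succ, nqps_add]
    simp [nqps]
  linear_combination (X ^ (n * (n - 1) / 2) * (qp n)⁻¹ * g n) * h

theorem wsum_eq_of_shift {a : ℕ} {f g : ℕ → ℚ⟦X⟧} (h : ℕ → ℚ⟦X⟧)
    (H : ∀ n, f n - (1 - X ^ n) * h n + X ^ n * ((1 + X ^ (a + n + 1)) * h (n + 1)) = g n) :
    wsum a f = wsum a g := by
  rw [show g = _ from funext fun n => (H n).symm]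
  simp only [← mul_assoc (X ^ _ : ℚ⟦X⟧) (1 + _)]
  rw [wsum_add, wsum_sub, wsum_one_sub_mul]
  ring

/-- The multisum over `λ_1 ≥ … ≥ λ_κ ≥ 0` of
`(-q^{a+1})_{λ_1} q^{λ_1(λ_1-1)/2 + bλ_1 + ∑_{i≥2} (λ_i² + cλ_i) + ∑_{i>m} λ_i} / (q)_λ`,
computed by summing over the smallest part `n = λ_κ` and subtracting `n` from all parts. -/
def multisum : ℕ → ℕ → ℕ → ℕ → ℕ → ℚ⟦X⟧
  | 0, _, _, _, _ => 1
  | κ + 1, m, a, b, c => wsum a fun n =>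
      X ^ (b * n + c * κ * n + κ * n ^ 2 + (κ + 1 - m) * n) *
        multisum κ m (a + n) (b + n) (c + 2 * n)

theorem multisum_congr_of_le {κ m m' : ℕ} (hm : κ ≤ m) (hm' : κ ≤ m') (a b c : ℕ) :
    multisum κ m a b c = multisum κ m' a b c := by
  induction κ generalizing a b c with
  | zero => rfl
  | succ κ ih =>
    simp only [multisum, Nat.sub_eq_zero_of_le hm, Nat.sub_eq_zero_of_le hm',
      ih (by omega) (by omega)]

theorem one_add_mul_multisum (κ m a b c : ℕ) :
    (1 + X ^ (a + 1)) * multisum κ m (a + 1) b c =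
      multisum κ m a b c + X ^ (a + 1) * multisum κ m a (b + 1) c := by
  induction κ generalizing a b c with
  | zero => simp [multisum]
  | succ κ ih =>
    simp only [multisum]
    rw [one_add_mul_wsum_succ, ← wsum_mul_left, ← wsum_add]
    congr 1
    funext n
    have h := ih (a + n) (b + n) (c + 2 * n)
    rw [show a + n + 1 = a + 1 + n by omega, show b + n + 1 = b + 1 + n by omega] at h
    rw [show a + n + 1 = a + 1 + n by omega]
    linear_combination X ^ (b * n + c * κ * n + κ * n ^ 2 + (κ + 1 - m) * n) * h

theorem multisum_succ_right {κ m : ℕ} (hm : κ ≤ m) (a b c : ℕ) :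
    multisum κ m a b (c + 1) = multisum κ 1 a b c := by
  induction κ generalizing a b c with
  | zero => rfl
  | succ κ ih =>
    simp only [multisum, Nat.sub_eq_zero_of_le hm, Nat.add_sub_cancel]
    congr 1
    funext n
    rw [show c + 1 + 2 * n = c + 2 * n + 1 by omega, ih (by omega)]
    congr 2
    ring

theorem multisum_zero_eq_multisum_one (κ a b c : ℕ) :
    multisum κ 0 a b c = multisum κ 1 a (b + 1) c := by
  induction κ generalizing a b c with
  | zero => rfl
  | succ κ ih =>
    simp only [multisum, Nat.sub_zero, Nat.add_sub_cancel]
    congr 1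
    funext n
    rw [show b + 1 + n = b + n + 1 by omega, ih]
    congr 2
    ring

theorem one_add_mul_multisum_of_le {κ m : ℕ} (hm : κ ≤ m) (a b c : ℕ) :
    (1 + X ^ (a + 1)) * multisum κ m (a + 1) b (c + 1) =
      multisum κ 1 a b c + X ^ (a + 1) * multisum κ 0 a b c := by
  rw [one_add_mul_multisum, multisum_succ_right hm, multisum_succ_right hm,
    multisum_zero_eq_multisum_one]

/-- The relation between consecutive multisums, where `κ = m + p + 1`. -/
def DifferenceRel (κ : ℕ) : Prop :=
  ∀ m p a b b' c c', m + p + 1 = κ → b' = b + 1 → c = a + b → c' = c + 1 →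
    multisum κ (m + 1) a b c = multisum κ m a b c +
      (X ^ (b + c' * m) * multisum κ (p + 1) a b' c' + X ^ (c' * (m + 1)) * multisum κ p a b' c')

/-- The relation expressing multisums with a lowered weight on the largest part. -/
def LoweringRel (κ : ℕ) : Prop :=
  ∀ m a b b' c, m < κ → b' = b + 1 → c = a + b' →
    multisum κ (m + 1) a b c = multisum κ (m + 2) a b' c +
      (X ^ b * multisum κ (m + 1) a b' c + X ^ c * multisum κ m a b' c)

theorem DifferenceRel.succ {κ : ℕ} (hA : DifferenceRel κ) (hB : LoweringRel κ) :
    DifferenceRel (κ + 1) := by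
  rintro m p a b _ _ _ hk rfl rfl rfl
  simp only [multisum]
  rw [← wsum_mul_left, ← wsum_mul_left, ← wsum_add, ← wsum_add]
  obtain rfl : m + p = κ := by omega
  rw [show m + p + 1 - (m + 1) = p by omega, show m + p + 1 - m = p + 1 by omega,
    show m + p + 1 - (p + 1) = m by omega, show m + p + 1 - p = m + 1 by omega]
  refine wsum_eq_of_shift (fun n =>
    X ^ (b * n + (a + b) * (m + p) * n + (m + p) * n ^ 2 + p * n) *
      multisum (m + p) m (a + n) (b + n) (a + b + 2 * n)) fun n => ?_
  rcases p with _ | p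
  · have h := one_add_mul_multisum_of_le (Nat.le_refl m) (a + n) (b + n + 1) (a + b + 2 * n + 1)
    rw [multisum_congr_of_le (κ := m + 0) (m := m + 1) (m' := m) (by omega) (by omega)]
    simp only [add_zero, zero_add] at h ⊢
    simp only [show a + (n + 1) = a + n + 1 by omega, show b + (n + 1) = b + n + 1 by omega,
      show a + b + 2 * (n + 1) = a + b + 2 * n + 1 + 1 by omega,
      show b + 1 + n = b + n + 1 by omega, show a + b + 1 + 2 * n = a + b + 2 * n + 1 by omega]
    linear_combination
      X ^ n * X ^ (b * (n + 1) + (a + b) * m * (n + 1) + m * (n + 1) ^ 2) * h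
  · rw [hA m p (a + n) (b + n) (b + 1 + n) (a + b + 2 * n) (a + b + 1 + 2 * n) (by omega)
      (by omega) (by omega) (by omega)]
    have hlow : (1 + X ^ (a + n + 1)) * multisum (m + (p + 1)) m (a + (n + 1)) (b + (n + 1))
        (a + b + 2 * (n + 1)) =
        multisum (m + (p + 1)) (m + 1) (a + n) (b + n + 2) (a + b + 2 * n + 2) +
        X ^ (a + n + 1) * multisum (m + (p + 1)) m (a + n) (b + n + 2) (a + b + 2 * n + 2) +
        if m = 0 then 0 else
        X ^ (b + n + 1) * multisum (m + (p + 1)) m (a + n) (b + n + 2) (a + b + 2 * n + 2) +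
        X ^ (a + b + 2 * n + 2) *
          multisum (m + (p + 1)) (m - 1) (a + n) (b + n + 2) (a + b + 2 * n + 2) := by
      rw [← add_assoc a, ← add_assoc b, one_add_mul_multisum,
        show a + b + 2 * (n + 1) = a + b + 2 * n + 2 by omega]
      rcases m with _ | m
      · rw [multisum_zero_eq_multisum_one]
        simp [add_assoc]
      · rw [hB m (a + n) (b + n + 1) (b + n + 2) _ (by omega) rfl (by omega)]
        simp only [add_assoc, Nat.add_sub_cancel, Nat.add_eq_zero_iff, one_ne_zero, and_false,
          if_false]
        ring_nf
    have h1 := hA p m (a + n) (b + 1 + n) (b + n + 2) (a + b + 1 + 2 * n) (a + b + 2 * n + 2)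
      (by omega) (by omega) (by omega) (by omega)
    have h2 : multisum (m + (p + 1)) (p + 2) (a + n) (b + 1 + n) (a + b + 1 + 2 * n) =
        multisum (m + (p + 1)) (p + 1) (a + n) (b + 1 + n) (a + b + 1 + 2 * n) +
        if m = 0 then 0 else
        X ^ (b + 1 + n + (a + b + 2 * n + 2) * (p + 1)) *
          multisum (m + (p + 1)) m (a + n) (b + n + 2) (a + b + 2 * n + 2) +
        X ^ ((a + b + 2 * n + 2) * (p + 2)) *
          multisum (m + (p + 1)) (m - 1) (a + n) (b + n + 2) (a + b + 2 * n + 2) := by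
      rcases m with _ | m
      · rw [multisum_congr_of_le (m := p + 2) (m' := p + 1) (by omega) (by omega)]
        simp
      · rw [hA (p + 1) m (a + n) (b + 1 + n) (b + n + 2) (a + b + 1 + 2 * n) (a + b + 2 * n + 2)
          (by omega) (by omega) (by omega) (by omega)]
        simp
    rw [show p + 1 + 1 = p + 2 from rfl, h2, h1, mul_assoc, mul_left_comm (1 + _), hlow]
    rcases m with _ | m
    · simp only [if_true]
      ring
    · simp only [Nat.add_eq_zero_iff, one_ne_zero, and_false, if_false, Nat.add_sub_cancel]
      ring

theorem DifferenceRel.loweringRel_succ {κ : ℕ} (hA : DifferenceRel κ) (hB : LoweringRel κ) :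
    LoweringRel (κ + 1) := by
  rintro m a b _ _ hm rfl rfl
  simp only [multisum]
  rw [← wsum_mul_left, ← wsum_mul_left, ← wsum_add, ← wsum_add]
  rcases Nat.lt_succ_iff_lt_or_eq.1 hm with hm | rfl
  · congr 1
    funext n
    rw [hB m (a + n) (b + n) (b + 1 + n) (a + (b + 1) + 2 * n) hm (by omega) (by omega)]
    obtain ⟨p, rfl⟩ := Nat.exists_eq_add_of_lt hm
    rw [show m + p + 1 + 1 - (m + 1) = p + 1 by omega,
      show m + p + 1 + 1 - (m + 2) = p by omega, show m + p + 1 + 1 - m = p + 2 by omega]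
    ring
  · rcases m with _ | m
    · refine wsum_eq_of_shift (fun n => X ^ (b * n)) fun n => ?_
      simp only [multisum]
      ring
    · refine wsum_eq_of_shift (fun n => X ^ (b * n + (a + (b + 1)) * (m + 1) * n + (m + 1) * n ^ 2)
        * multisum (m + 1) (m + 1) (a + n) (b + 1 + n) (a + (b + 1) + 2 * n)) fun n => ?_
      have h := one_add_mul_multisum_of_le (Nat.le_refl (m + 1)) (a + n) (b + n + 2)
        (a + b + 2 * n + 2)
      have h1 := hA m 0 (a + n) (b + 1 + n) (b + n + 2) (a + (b + 1) + 2 * n) (a + b + 2 * n + 2)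
        (by omega) (by omega) (by omega) (by omega)
      have h2 := hB m (a + n) (b + n) (b + 1 + n) (a + (b + 1) + 2 * n) (by omega) (by omega)
        (by omega)
      rw [multisum_congr_of_le (m := m + 2) (m' := m + 1) (by omega) (by omega)] at h2
      rw [multisum_congr_of_le (m := m + 1 + 1) (m' := m + 1) (by omega) (by omega),
        multisum_congr_of_le (m := m + 1 + 2) (m' := m + 1) (by omega) (by omega),
        multisum_congr_of_le (m := m + 1 + 1) (m' := m + 1) (by omega) (by omega), h2]
      simp only [show a + (n + 1) = a + n + 1 by omega, show b + 1 + (n + 1) = b + n + 2 by omega,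
        show a + (b + 1) + 2 * (n + 1) = a + b + 2 * n + 2 + 1 by omega]
      rw [mul_left_comm (1 + _), h]
      simp only [Nat.sub_self, show m + 1 + 1 - (m + 1 + 2) = 0 by omega,
        show m + 1 + 1 - (m + 1) = 1 by omega]
      linear_combination
        (-(X ^ (b * n + (a + (b + 1)) * (m + 1) * n + (m + 1) * n ^ 2) *
          X ^ (a + (b + 1) + 2 * n))) * h1

theorem differenceRel_and_loweringRel (κ : ℕ) : DifferenceRel κ ∧ LoweringRel κ := by
  induction κ with
  | zero => exact ⟨fun m p a b b' c c' h => by omega, fun m a b b' c h => by omega⟩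
  | succ κ ih => exact ⟨ih.1.succ ih.2, ih.1.loweringRel_succ ih.2⟩

/-- The summand of `multisum` at the tuple `f 0 ≥ f 1 ≥ … ≥ f (κ-1)`. -/
def multisumTerm (κ m a b c : ℕ) (f : ℕ → ℕ) : ℚ⟦X⟧ :=
  nqps a (f 0) * X ^ (f 0 * (f 0 - 1) / 2 + b * f 0 + (∑ i ∈ Finset.Ico 1 κ, (f i ^ 2 + c * f i)) +
    ∑ i ∈ Finset.Ico m κ, f i) * (qpT κ f)⁻¹

theorem DecTuple.finite_setOf_le (κ d : ℕ) : {f : DecTuple κ | f.1 0 ≤ d}.Finite := by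
  have hinj : Function.Injective fun (f : DecTuple κ) (i : Fin κ) => f.1 i := by
    intro f g h
    refine Subtype.ext (funext fun i => ?_)
    rcases lt_or_ge i κ with hi | hi
    · exact congrFun h ⟨i, hi⟩
    · rw [f.2.2 i hi, g.2.2 i hi]
  refine ((Set.finite_Icc (0 : Fin κ → ℕ) fun _ => d).preimage hinj.injOn).subset fun f hf => ?_
  exact ⟨fun i => Nat.zero_le _, fun i => (f.2.1 (Nat.zero_le _)).trans hf⟩

theorem summable_multisumTerm (κ m a b c : ℕ) :
    Summable fun f : DecTuple κ => multisumTerm κ m a b c f.1 := by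
  refine summable_of_finite_coeff fun d => (DecTuple.finite_setOf_le κ (d + 1)).subset fun f hf => ?_
  by_contra hlt
  simp only [Set.mem_ofPred_eq, not_le] at hlt
  have h : X ^ (f.1 0 - 1) ∣ multisumTerm κ m a b c f.1 := by
    refine ((pow_dvd_pow X ?_).mul_left _).mul_right _
    have := pred_le_choose_two (f.1 0)
    omega
  exact hf (X_pow_dvd_iff.1 h d (by omega))

/-- Splitting off the smallest part `n` of a tuple and subtracting it from the other parts. -/
def DecTuple.succEquiv (κ : ℕ) : DecTuple (κ + 1) ≃ ℕ × DecTuple κ where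
  toFun f := (f.1 κ, ⟨fun i => f.1 i - f.1 κ, fun _ _ h => Nat.sub_le_sub_right (f.2.1 h) _,
    fun _ h => Nat.sub_eq_zero_of_le (f.2.1 h)⟩)
  invFun p := ⟨fun i => if i ≤ κ then p.2.1 i + p.1 else 0, fun i j h => by
    have := p.2.2.1 h
    dsimp only
    split_ifs <;> omega, fun i h => if_neg (by omega)⟩
  left_inv f := by
    refine Subtype.ext (funext fun i => ?_)
    dsimp only
    split_ifs with h
    · exact Nat.sub_add_cancel (f.2.1 h)
    · exact (f.2.2 i (by omega)).symm
  right_inv p := by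
    have h0 : p.2.1 κ = 0 := p.2.2.2 κ le_rfl
    refine Prod.ext (by simp [h0]) (Subtype.ext (funext fun i => ?_))
    rcases le_or_gt i κ with h | h
    · simp [h, h0]
    · simp [h.not_ge, p.2.2.2 i h.le]

theorem multisumTerm_succEquiv_symm (κ m a b c n : ℕ) (g : DecTuple κ) :
    multisumTerm (κ + 1) m a b c ((DecTuple.succEquiv κ).symm (n, g)).1 =
      nqps a n * X ^ (n * (n - 1) / 2) * (qp n)⁻¹ *
        (X ^ (b * n + c * κ * n + κ * n ^ 2 + (κ + 1 - m) * n) *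
          multisumTerm κ m (a + n) (b + n) (c + 2 * n) g.1) := by
  set f := ((DecTuple.succEquiv κ).symm (n, g)).1 with hf
  have hle {i : ℕ} (hi : i ≤ κ) : f i = g.1 i + n := if_pos hi
  have hgκ : g.1 κ = 0 := g.2.2 κ le_rfl
  have hqp : qpT (κ + 1) f = qp n * qpT κ g.1 := by
    rw [qpT, Finset.prod_range_succ, hle le_rfl, hgκ, show f (κ + 1) = 0 from if_neg (by omega),
      zero_add, Nat.sub_zero, mul_comm, qpT]
    congr 1
    refine Finset.prod_congr rfl fun i hi => ?_
    rw [Finset.mem_range] at hi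
    rw [hle hi.le, hle hi, Nat.add_sub_add_right]
  have hsum : ∑ i ∈ Finset.Ico m (κ + 1), f i =
      (∑ i ∈ Finset.Ico m κ, g.1 i) + (κ + 1 - m) * n := by
    rw [Finset.sum_congr rfl fun i hi => hle (Nat.lt_succ_iff.1 (Finset.mem_Ico.1 hi).2),
      Finset.sum_add_distrib, Finset.sum_const, Nat.card_Ico, smul_eq_mul]
    congr 1
    rcases le_or_gt m κ with h | h
    · rw [Finset.sum_Ico_succ_top h, hgκ, add_zero]
    · rw [Finset.Ico_eq_empty_of_le h, Finset.Ico_eq_empty_of_le h.le]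
  have hsq : ∑ i ∈ Finset.Ico 1 (κ + 1), (f i ^ 2 + c * f i) =
      (∑ i ∈ Finset.Ico 1 κ, (g.1 i ^ 2 + (c + 2 * n) * g.1 i)) + κ * (n ^ 2 + c * n) := by
    have h : ∑ i ∈ Finset.Ico 1 (κ + 1), (g.1 i ^ 2 + (c + 2 * n) * g.1 i) =
        ∑ i ∈ Finset.Ico 1 κ, (g.1 i ^ 2 + (c + 2 * n) * g.1 i) := by
      rcases κ with _ | κ
      · rfl
      · rw [Finset.sum_Ico_succ_top (by omega), hgκ]
        simp
    rw [← h, Finset.sum_congr rfl fun i hi => by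
      rw [hle (Nat.lt_succ_iff.1 (Finset.mem_Ico.1 hi).2), show (g.1 i + n) ^ 2 + c * (g.1 i + n) =
        (g.1 i ^ 2 + (c + 2 * n) * g.1 i) + (n ^ 2 + c * n) by ring],
      Finset.sum_add_distrib, Finset.sum_const, Nat.card_Ico, smul_eq_mul, Nat.add_sub_cancel]
  rw [multisumTerm, hqp, hsum, hsq, hle (Nat.zero_le κ), nqps_add, choose_two_add, multisumTerm,
    PowerSeries.mul_inv_rev]
  ring

theorem tsum_multisumTerm (κ m a b c : ℕ) :
    ∑' f : DecTuple κ, multisumTerm κ m a b c f.1 = multisum κ m a b c := by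
  induction κ generalizing a b c with
  | zero =>
    have h0 (f : DecTuple 0) : f.1 = fun _ => 0 := funext fun i => f.2.2 i (Nat.zero_le i)
    have : Unique (DecTuple 0) :=
      ⟨⟨⟨fun _ => 0, fun _ _ _ => le_rfl, fun _ _ => rfl⟩⟩, fun f => Subtype.ext (h0 f)⟩
    rw [(hasSum_unique _).tsum_eq]
    simp [h0, multisumTerm, multisum, nqps, qpT]
  | succ κ ih =>
    have hs := (DecTuple.succEquiv κ).symm.summable_iff.2 (summable_multisumTerm (κ + 1) m a b c)
    have hfib (n : ℕ) (r s : ℚ⟦X⟧) :=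
      ((summable_multisumTerm κ m (a + n) (b + n) (c + 2 * n)).mul_left r).mul_left s
    rw [← (DecTuple.succEquiv κ).symm.tsum_eq]
    refine (hs.tsum_prod' fun n => ?_).trans (tsum_congr fun n => ?_)
    · simp only [Function.comp_apply, multisumTerm_succEquiv_symm]
      exact hfib n _ _
    · simp only [Function.comp_apply, multisumTerm_succEquiv_symm]
      rw [((summable_multisumTerm _ _ _ _ _).mul_left _).tsum_mul_left,
        (summable_multisumTerm _ _ _ _ _).tsum_mul_left, ih]

theorem two_mul_sum_multisum (κ m : ℕ) (hm : m ≤ κ) :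
    2 * (∑ i ∈ Finset.range m, X ^ i * multisum κ (κ - i) 0 1 1) +
      X ^ m * multisum κ (κ - m) 0 1 1 = multisum κ m 0 0 0 := by
  induction m with
  | zero =>
    rw [multisum_zero_eq_multisum_one, ← multisum_succ_right (Nat.le_refl κ)]
    simp
  | succ m ih =>
    obtain ⟨p, rfl⟩ := Nat.exists_eq_add_of_le' hm
    rw [(differenceRel_and_loweringRel _).1 m p 0 0 1 0 1 (by omega) rfl rfl rfl, ← ih (by omega),
      Finset.sum_range_succ, show p + (m + 1) - (m + 1) = p by omega,
      show p + (m + 1) - m = p + 1 by omega]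
    ring

theorem mul_succ_div_two (n : ℕ) : n * (n + 1) / 2 = n * (n - 1) / 2 + n := by
  simpa [mul_comm, add_comm] using choose_two_add n 1

theorem sum_range_reflect_add_one (f : ℕ → ℕ) {k i : ℕ} (hi : i ≤ k) :
    ∑ j ∈ Finset.range i, (f (k - 1 - j) + 1) = i + ∑ j ∈ Finset.Ico (k - i) k, f j := by
  induction i with
  | zero => simp
  | succ i ih =>
    rw [Finset.sum_range_succ, ih (by omega), Finset.sum_eq_sum_Ico_succ_bot (show k - (i + 1) < k by omega),
      show k - (i + 1) + 1 = k - i by omega, show k - 1 - i = k - (i + 1) by omega]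
    ring

/-- Proposition `second lemma`  (`f.1 t` is `λ_{t+1}`). -/
theorem stmt12 (k m : ℕ) (hk : 1 ≤ k) (hm : m ≤ k) :
    (∑' f : DecTuple k,
        nqp (f.1 0) *
            (X : ℚ⟦X⟧) ^ (f.1 0 * (f.1 0 + 1) / 2 +
              ∑ i ∈ Finset.Ico 1 k, (f.1 i ^ 2 + f.1 i)) *
            (qpT k f.1)⁻¹ *
          (2 * (∑ i ∈ Finset.range m,
              (X : ℚ⟦X⟧) ^ ∑ j ∈ Finset.range i, (f.1 (k - 1 - j) + 1)) +
            (X : ℚ⟦X⟧) ^ ∑ j ∈ Finset.range m, (f.1 (k - 1 - j) + 1))) =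
      ∑' f : DecTuple k,
        nqp (f.1 0) *
          (X : ℚ⟦X⟧) ^ (f.1 0 * (f.1 0 - 1) / 2 + (∑ i ∈ Finset.Ico 1 k, f.1 i ^ 2) +
            ∑ i ∈ Finset.Ico m k, f.1 i) * (qpT k f.1)⁻¹ := by
  have hnqp (n : ℕ) : nqp n = nqps 0 n := by simp [nqp, nqps]
  have hterm (f : DecTuple k) {i : ℕ} (hi : i ≤ k) :
      nqp (f.1 0) * (X : ℚ⟦X⟧) ^ (f.1 0 * (f.1 0 + 1) / 2 +
        ∑ i ∈ Finset.Ico 1 k, (f.1 i ^ 2 + f.1 i)) * (qpT k f.1)⁻¹ *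
          X ^ ∑ j ∈ Finset.range i, (f.1 (k - 1 - j) + 1) =
      X ^ i * multisumTerm k (k - i) 0 1 1 f.1 := by
    rw [sum_range_reflect_add_one _ hi, mul_succ_div_two, multisumTerm, hnqp]
    simp only [one_mul]
    ring
  have hs (i : ℕ) : Summable fun f : DecTuple k => X ^ i * multisumTerm k (k - i) 0 1 1 f.1 :=
    (summable_multisumTerm _ _ _ _ _).mul_left _
  calc
    _ = ∑' f : DecTuple k, (2 * (∑ i ∈ Finset.range m, X ^ i * multisumTerm k (k - i) 0 1 1 f.1) +
          X ^ m * multisumTerm k (k - m) 0 1 1 f.1) := by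
      refine tsum_congr fun f => ?_
      rw [mul_add, hterm f hm, mul_left_comm, Finset.mul_sum, Finset.sum_congr rfl fun i hi =>
        hterm f ((Finset.mem_range.1 hi).le.trans hm)]
    _ = multisum k m 0 0 0 := by
      have hsum := summable_sum fun i (_ : i ∈ Finset.range m) => hs i
      rw [(hsum.mul_left 2).tsum_add (hs m), hsum.tsum_mul_left,
        Summable.tsum_finsetSum fun i _ => hs i, ← two_mul_sum_multisum k m hm]
      simp only [(summable_multisumTerm _ _ _ _ _).tsum_mul_left, tsum_multisumTerm]
    _ = _ := by
      rw [← tsum_multisumTerm]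
      refine tsum_congr fun f => ?_
      simp [multisumTerm, hnqp]
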